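/- Let η ∈ (0, 1/√12], set C₀ = (1−√3η)/(1+√3η), C₁ = 2√3η, C₂ = 1/(1+√3η). Let g : ℝ² → ℂ be continuously differentiable, let τ be uniformly distributed on [−√3η, √3η], and define g_η(ω₁,ω₂) = E_τ[(1−τ)³ g((1−τ)ω₁,(1−τ)ω₂)]. Then for every r > 0 and θ: g(r,θ) − C₀⁴ g(C₀ r, θ) = C₁ C₂⁴ (4 g_η(C₂ r, θ) + C₂ r ∂_r g_η(C₂ r, θ)); that is, (I − L_{C₀}) g = C₁ L_{C₂}(4 g_η + r ∂_r g_η). -/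

import Mathlib

open MeasureTheory Complex Real

/-- Polar coordinates: the point of `ℝ²` at radius `r` and angle `θ`. -/
noncomputable def polar (r θ : ℝ) : ℝ × ℝ := (r * Real.cos θ, r * Real.sin θ)

theorem smul_polar (c r θ : ℝ) : c • polar r θ = polar (c * r) θ := by
  simp [polar, mul_assoc]

theorem continuous_polar_left (θ : ℝ) : Continuous fun s : ℝ => polar s θ := by
  unfold polar
  fun_prop

/-- Substituting `u = (1 - τ) s` in the weighted dilation average of a radial profile. -/
theorem integral_dilation_eq {φ : ℝ → ℂ} (hφ : Continuous φ) (a : ℝ) {s : ℝ} (hs : s ≠ 0) :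
    ∫ τ in (-a)..a, ((1 : ℂ) - τ) ^ 3 * φ ((1 - τ) * s) =
      ((s : ℂ) ^ 4)⁻¹ * ((∫ u in (0 : ℝ)..((1 + a) * s), (u : ℂ) ^ 3 * φ u) -
        ∫ u in (0 : ℝ)..((1 - a) * s), (u : ℂ) ^ 3 * φ u) := by
  have hs' : (s : ℂ) ≠ 0 := by exact_mod_cast hs
  have hc : Continuous fun u : ℝ => (u : ℂ) ^ 3 * φ u := by fun_prop
  rw [intervalIntegral.integral_interval_sub_left (hc.intervalIntegrable _ _)
    (hc.intervalIntegrable _ _)]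
  have h := intervalIntegral.integral_comp_sub_mul (a := -a) (b := a)
    (fun u : ℝ => (u : ℂ) ^ 3 * φ u) hs s
  rw [show s - s * a = (1 - a) * s by ring, show s - s * -a = (1 + a) * s by ring] at h
  have hI : ∀ τ : ℝ, ((1 : ℂ) - τ) ^ 3 * φ ((1 - τ) * s) =
      ((s : ℂ) ^ 3)⁻¹ * (((s - s * τ : ℝ) : ℂ) ^ 3 * φ (s - s * τ)) := by
    intro τ
    rw [show s - s * τ = (1 - τ) * s by ring]
    push_cast
    field_simp
  simp_rw [hI]
  rw [intervalIntegral.integral_const_mul, h, Complex.real_smul]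
  push_cast
  field_simp

/-- The unnormalized dilation average is differentiable in the radius, and four times it plus its
Euler derivative is a difference of boundary values of the profile. -/
theorem hasDerivAt_dilation_average {φ : ℝ → ℂ} (hφ : Continuous φ) (a : ℝ) {s : ℝ}
    (hs : 0 < s) :
    ∃ d : ℂ, HasDerivAt
        (fun s : ℝ => ∫ τ in (-a)..a, ((1 : ℂ) - τ) ^ 3 * φ ((1 - τ) * s)) d s ∧
      4 * (∫ τ in (-a)..a, ((1 : ℂ) - τ) ^ 3 * φ ((1 - τ) * s)) + (s : ℂ) * d =
        (1 + a : ℂ) ^ 4 * φ ((1 + a) * s) - (1 - a : ℂ) ^ 4 * φ ((1 - a) * s) := by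
  have hs' : (s : ℂ) ≠ 0 := by exact_mod_cast hs.ne'
  have hc : Continuous fun u : ℝ => (u : ℂ) ^ 3 * φ u := by fun_prop
  have hF : ∀ c : ℝ, HasDerivAt
      (fun s : ℝ => ∫ u in (0 : ℝ)..(c * s), (u : ℂ) ^ 3 * φ u)
      (c • (((c * s : ℝ) : ℂ) ^ 3 * φ (c * s))) s := fun c =>
    (hc.integral_hasStrictDerivAt 0 (c * s)).hasDerivAt.scomp s
      (by simpa using (hasDerivAt_id s).const_mul c)
  have hinv : HasDerivAt (fun s : ℝ => ((s : ℂ) ^ 4)⁻¹) _ s :=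
    ((hasDerivAt_id s).ofReal_comp.pow 4).inv (pow_ne_zero 4 hs')
  refine ⟨_, (hinv.mul ((hF (1 + a)).sub (hF (1 - a)))).congr_of_eventuallyEq ?_, ?_⟩
  · filter_upwards [eventually_ne_nhds hs.ne'] with t ht
    exact integral_dilation_eq hφ a ht
  · rw [integral_dilation_eq hφ a hs.ne']
    simp only [Complex.real_smul, Pi.sub_apply, Pi.pow_apply, id]
    push_cast
    field_simp
    ring

/-- Let `η ∈ (0, 1/√12]`, `C₀ = (1-√3η)/(1+√3η)`, `C₁ = 2√3η`, `C₂ = 1/(1+√3η)`, `g` continuously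
differentiable, `τ` uniform on `[-√3η, √3η]`, and `g_η(ω) = E_τ[(1-τ)³ g((1-τ)ω)]`. Then for all
`r > 0` and `θ`:
`g(r,θ) - C₀⁴ g(C₀ r, θ) = C₁ C₂⁴ (4 g_η(C₂ r, θ) + C₂ r ∂_r g_η(C₂ r, θ))`,
i.e. `(I - L_{C₀}) g = C₁ L_{C₂}(4 g_η + r ∂_r g_η)`. -/
theorem stmt5 (η : ℝ) (hη : 0 < η) (hη' : η ≤ 1 / Real.sqrt 12)
    (C₀ C₁ C₂ : ℝ)
    (hC₀ : C₀ = (1 - Real.sqrt 3 * η) / (1 + Real.sqrt 3 * η))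
    (hC₁ : C₁ = 2 * Real.sqrt 3 * η)
    (hC₂ : C₂ = 1 / (1 + Real.sqrt 3 * η))
    (g : ℝ × ℝ → ℂ) (hg : ContDiff ℝ 1 g)
    (gη : ℝ × ℝ → ℂ)
    (hgη : ∀ ω : ℝ × ℝ, gη ω = (2 * Real.sqrt 3 * η)⁻¹ •
      ∫ τ in (-(Real.sqrt 3 * η))..(Real.sqrt 3 * η), ((1 : ℂ) - τ)^3 * g ((1 - τ) • ω))
    (r θ : ℝ) (hr : 0 < r) :
    ∃ d : ℂ, HasDerivAt (fun s : ℝ => gη (polar s θ)) d (C₂ * r) ∧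
      g (polar r θ) - (C₀ : ℂ)^4 * g (polar (C₀ * r) θ)
        = (C₁ : ℂ) * (C₂ : ℂ)^4 * (4 * gη (polar (C₂ * r) θ) + ((C₂ * r : ℝ) : ℂ) * d) := by
  set a : ℝ := Real.sqrt 3 * η with ha
  have ha0 : 0 < a := by positivity
  have ha1 : 1 + a ≠ 0 := by positivity
  have hφ : Continuous fun s : ℝ => g (polar s θ) :=
    hg.continuous.comp (continuous_polar_left θ)
  have hs : 0 < C₂ * r := by rw [hC₂]; positivity
  obtain ⟨d, hd, h⟩ := hasDerivAt_dilation_average hφ a hs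
  have hgp : ∀ s, gη (polar s θ) = (2 * a)⁻¹ •
      ∫ τ in (-a)..a, ((1 : ℂ) - τ) ^ 3 * g (polar ((1 - τ) * s) θ) := by
    intro s
    rw [hgη, mul_assoc]
    simp_rw [smul_polar]
    rfl
  refine ⟨(2 * a)⁻¹ • d, ?_, ?_⟩
  · simp_rw [hgp]
    exact hd.const_smul ((2 * a)⁻¹ : ℝ)
  have h1 : (1 + a) * (C₂ * r) = r := by rw [hC₂]; field_simp
  have h2 : (1 - a) * (C₂ * r) = C₀ * r := by rw [hC₂, hC₀]; field_simp
  have hC₁' : C₁ = 2 * a := by rw [hC₁, ha]; ring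
  have haC : (a : ℂ) ≠ 0 := by exact_mod_cast ha0.ne'
  have ha1C : (1 + a : ℂ) ≠ 0 := by exact_mod_cast ha1
  rw [h1, h2] at h
  have key : (C₁ : ℂ) * (C₂ : ℂ) ^ 4 *
      (4 * gη (polar (C₂ * r) θ) + ((C₂ * r : ℝ) : ℂ) * ((2 * a)⁻¹ • d)) =
      (C₂ : ℂ) ^ 4 * ((1 + a : ℂ) ^ 4 * g (polar r θ) -
        (1 - a : ℂ) ^ 4 * g (polar (C₀ * r) θ)) := by
    rw [← h, hgp, hC₁']
    generalize (∫ τ in (-a)..a, ((1 : ℂ) - τ) ^ 3 * g (polar ((1 - τ) * (C₂ * r)) θ)) = I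
    simp only [Complex.real_smul]
    push_cast
    field_simp
  rw [key, hC₂, hC₀]
  push_cast
  field_simp
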